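/- Let A be a unital C*-algebra, let a ∈ A with 0 ≤ a, and let f : A → ℂ be a hermitian continuous linear functional. Then ‖√a·f·√a‖ = sInf { r ∈ ℝ : there exist positive continuous linear functionals f₁, f₂ on A with f = f₁ − f₂ and r = Re(f₁(a)) + Re(f₂(a)) }. -/

import Mathlib

set_option synthInstance.maxHeartbeats 1000000
set_option maxHeartbeats 1000000

open scoped ComplexOrder

/-- For `a` in a unital C*-algebra `A` and a continuous linear functional `f` on `A`,
`sandwich a f` is the continuous linear functional `x ↦ f (√a * x * √a)`. -/
noncomputable def sandwich {A : Type*} [CStarAlgebra A] [PartialOrder A] [StarOrderedRing A]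
    (a : A) (f : A →L[ℂ] ℂ) : A →L[ℂ] ℂ :=
  f.comp ((ContinuousLinearMap.mul ℂ A (CFC.sqrt a)).comp
    ((ContinuousLinearMap.mul ℂ A).flip (CFC.sqrt a)))

lemma sandwich_apply {A : Type*} [CStarAlgebra A] [PartialOrder A] [StarOrderedRing A]
    (a : A) (f : A →L[ℂ] ℂ) (x : A) :
    sandwich a f x = f (CFC.sqrt a * x * CFC.sqrt a) := by
  simp [sandwich, mul_assoc]

section

open scoped ComplexStarModule

variable {A : Type*} [CStarAlgebra A]

lemma im_apply_eq_zero_of_isSelfAdjoint {f : A →L[ℂ] ℂ}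
    (hf : ∀ x : A, f (star x) = starRingEnd ℂ (f x)) {x : A} (hx : IsSelfAdjoint x) :
    (f x).im = 0 := by
  have := hf x
  rw [hx.star_eq] at this
  exact Complex.conj_eq_iff_im.mp this.symm

lemma re_apply_eq_re_apply_realPart {f : A →L[ℂ] ℂ}
    (hf : ∀ x : A, f (star x) = starRingEnd ℂ (f x)) (x : A) :
    (f x).re = (f (ℜ x : A)).re := by
  conv_lhs => rw [← realPart_add_I_smul_imaginaryPart x]
  simp [im_apply_eq_zero_of_isSelfAdjoint hf (ℑ x).2]

variable [PartialOrder A] [StarOrderedRing A]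

lemma IsSelfAdjoint.norm_le_of_mem_Icc_algebraMap {x : A} {t : ℝ} (hx : IsSelfAdjoint x)
    (ht : 0 ≤ t) (h₁ : -algebraMap ℝ A t ≤ x) (h₂ : x ≤ algebraMap ℝ A t) : ‖x‖ ≤ t := by
  rw [← map_neg, algebraMap_le_iff_le_spectrum] at h₁
  rw [le_algebraMap_iff_spectrum_le] at h₂
  rw [← cfc_id ℝ x]
  exact norm_cfc_le ht fun y hy ↦ abs_le.mpr ⟨h₁ y hy, h₂ y hy⟩

lemma apply_star_of_nonneg {φ : A →L[ℂ] ℂ} (hφ : ∀ x : A, 0 ≤ x → 0 ≤ φ x) (x : A) :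
    φ (star x) = starRingEnd ℂ (φ x) :=
  map_star (PositiveLinearMap.mk₀ (φ : A →ₗ[ℂ] ℂ) hφ) x

lemma norm_le_re_apply_one_of_nonneg {φ : A →L[ℂ] ℂ} (hφ : ∀ x : A, 0 ≤ x → 0 ≤ φ x) :
    ‖φ‖ ≤ (φ 1).re := by
  have h1 : 0 ≤ (φ 1).re := (Complex.nonneg_iff.mp (hφ 1 zero_le_one)).1
  refine φ.opNorm_le_bound h1 fun x ↦ ?_
  obtain ⟨c, hc, hcx⟩ := RCLike.exists_norm_eq_mul_self (φ x)
  have hy : ‖(ℜ (c • x) : A)‖ ≤ ‖x‖ := by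
    simpa [norm_smul, hc] using realPart.norm_le (c • x)
  have hle : (ℜ (c • x) : A) ≤ algebraMap ℝ A ‖x‖ :=
    (IsSelfAdjoint.le_algebraMap_norm_self (ℜ (c • x)).2).trans (algebraMap_mono A hy)
  have hnn := (Complex.nonneg_iff.mp (hφ _ (sub_nonneg.mpr hle))).1
  have key : ‖φ x‖ = (φ (ℜ (c • x) : A)).re := by
    rw [← re_apply_eq_re_apply_realPart (apply_star_of_nonneg hφ), map_smul, smul_eq_mul, ← hcx]
    simp
  have h2 : φ (algebraMap ℝ A ‖x‖) = (‖x‖ : ℂ) * φ 1 := by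
    rw [Algebra.algebraMap_eq_smul_one, ← Complex.coe_smul, map_smul, smul_eq_mul]
  rw [map_sub, h2] at hnn
  simp at hnn
  rw [key]
  linarith

/-- A positive real-linear functional on the self-adjoint part extends to a positive
continuous functional. -/
lemma exists_nonneg_extension_of_selfAdjoint (h : selfAdjoint A →ₗ[ℝ] ℝ)
    (hh : ∀ x : selfAdjoint A, 0 ≤ (x : A) → 0 ≤ h x) :
    ∃ φ : A →L[ℂ] ℂ, (∀ x : A, 0 ≤ x → 0 ≤ φ x) ∧ ∀ x : selfAdjoint A, φ x = h x := by
  let L : A →ₗ[ℂ] ℂ := Module.Dual.extendRCLike (h.comp realPart)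
  have hL (x : selfAdjoint A) : L x = h x := by
    simp [L, Module.Dual.extendRCLike_apply, realPart_I_smul]
  have hL0 (x : A) (hx : 0 ≤ x) : 0 ≤ L x := by
    have := hL ⟨x, .of_nonneg hx⟩
    rw [this]
    exact_mod_cast hh ⟨x, .of_nonneg hx⟩ hx
  exact ⟨⟨L, map_continuous (PositiveLinearMap.mk₀ L hL0)⟩, hL0, hL⟩

/-- The cone of triples `(u, x, t)` with `0 ≤ t` such that `u + t` is an upper bound of both `x`
and `-x`. -/
def pairBoundCone (A : Type*) [CStarAlgebra A] [PartialOrder A] [StarOrderedRing A] :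
    PointedCone ℝ (selfAdjoint A × selfAdjoint A × ℝ) where
  carrier := {p | 0 ≤ (p.1 : A) + p.2.1 + algebraMap ℝ A p.2.2 ∧
    0 ≤ (p.1 : A) - p.2.1 + algebraMap ℝ A p.2.2 ∧ 0 ≤ p.2.2}
  add_mem' := by
    rintro ⟨u, x, t⟩ ⟨v, y, s⟩ ⟨h₁, h₂, h₃⟩ ⟨k₁, k₂, k₃⟩
    refine ⟨(add_nonneg h₁ k₁).trans_eq ?_, (add_nonneg h₂ k₂).trans_eq ?_, add_nonneg h₃ k₃⟩ <;>
    · simp only [Prod.mk_add_mk, AddSubgroup.coe_add, map_add]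
      abel
  zero_mem' := by simp
  smul_mem' := by
    rintro c ⟨u, x, t⟩ ⟨h₁, h₂, h₃⟩
    refine ⟨(smul_nonneg c.2 h₁).trans_eq ?_, (smul_nonneg c.2 h₂).trans_eq ?_,
      mul_nonneg c.2 h₃⟩ <;>
    · simp only [smul_add, smul_sub, Algebra.algebraMap_eq_smul_one, ← smul_assoc]
      rfl

lemma mem_pairBoundCone {u x : selfAdjoint A} {t : ℝ} :
    (u, x, t) ∈ pairBoundCone A ↔ 0 ≤ (u : A) + x + algebraMap ℝ A t ∧
      0 ≤ (u : A) - x + algebraMap ℝ A t ∧ 0 ≤ t := Iff.rfl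

/-- Jordan decomposition of hermitian functionals. The functionals are obtained by extending
`(0, x, t) ↦ g x + t ‖g‖` to a functional nonnegative on `pairBoundCone A`. -/
lemma exists_nonneg_sub_nonneg (g : A →L[ℂ] ℂ)
    (hg : ∀ x : A, g (star x) = starRingEnd ℂ (g x)) :
    ∃ g₁ g₂ : A →L[ℂ] ℂ, (∀ x : A, 0 ≤ x → 0 ≤ g₁ x) ∧ (∀ x : A, 0 ≤ x → 0 ≤ g₂ x) ∧
      g = g₁ - g₂ ∧ (g₁ 1).re + (g₂ 1).re ≤ ‖g‖ := by
  let ψ₀ : selfAdjoint A →ₗ[ℝ] ℝ :=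
    { toFun x := (g x).re
      map_add' x y := by simp
      map_smul' c x := by simp }
  let ψ : selfAdjoint A × selfAdjoint A × ℝ →ₗ[ℝ] ℝ :=
    LinearMap.coprod 0 (LinearMap.coprod ψ₀ (‖g‖ • LinearMap.id))
  have hψ (u x : selfAdjoint A) (t : ℝ) : ψ (u, x, t) = (g x).re + ‖g‖ * t := by simp [ψ, ψ₀]
  let D : Submodule ℝ (selfAdjoint A × selfAdjoint A × ℝ) := Submodule.prod ⊥ ⊤
  have hD (x : selfAdjoint A) (t : ℝ) : ((0 : selfAdjoint A), x, t) ∈ D := by simp [D]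
  obtain ⟨F, hF, hF0⟩ := riesz_extension (pairBoundCone A) ⟨D, ψ.comp D.subtype⟩
    (by
      rintro ⟨⟨u, x, t⟩, hD'⟩ hs
      obtain rfl : u = 0 := by simpa [D] using hD'
      change 0 ≤ ψ (0, x, t)
      rw [hψ]
      obtain ⟨h₁, h₂, h₃⟩ := mem_pairBoundCone.mp hs
      have hx : ‖(x : A)‖ ≤ t := x.2.norm_le_of_mem_Icc_algebraMap h₃
        (by simpa [neg_le_iff_add_nonneg] using h₁) (by simpa [neg_add_eq_sub] using h₂)
      have := (Complex.abs_re_le_norm _).trans (g.le_opNorm_of_le hx)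
      linarith [neg_abs_le (g x).re])
    (by
      rintro ⟨u, x, t⟩
      refine ⟨⟨(0, -x, ‖(u : A)‖ + |t|), hD _ _⟩, ?_⟩
      have hu := (IsSelfAdjoint.neg_algebraMap_norm_le_self u.2).trans' <| neg_le_neg <|
        algebraMap_mono A (show ‖(u : A)‖ ≤ ‖(u : A)‖ + |t| + t by linarith [neg_abs_le t])
      simp only [Prod.mk_add_mk, zero_add, neg_add_cancel, mem_pairBoundCone, ZeroMemClass.coe_zero,
        add_zero, sub_zero]
      have := neg_le_iff_add_nonneg'.mp hu
      rw [add_comm] at this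
      exact ⟨by simpa [add_comm] using this, by simpa [add_comm] using this, by
        linarith [neg_abs_le t, norm_nonneg (u : A)]⟩)
  have hFψ (x : selfAdjoint A) (t : ℝ) : F (0, x, t) = (g x).re + ‖g‖ * t := by
    rw [← hψ 0]
    exact hF ⟨_, hD x t⟩
  let incl (c : ℝ) : selfAdjoint A →ₗ[ℝ] selfAdjoint A × selfAdjoint A × ℝ :=
    LinearMap.prod ((2⁻¹ : ℝ) • LinearMap.id) (LinearMap.prod (c • LinearMap.id) 0)
  have hincl (c : ℝ) (x : selfAdjoint A) : incl c x = ((2⁻¹ : ℝ) • x, c • x, 0) := rfl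
  obtain ⟨g₁, hg₁, hg₁F⟩ := exists_nonneg_extension_of_selfAdjoint (F.comp (incl 2⁻¹)) (by
    intro x hx
    refine hF0 _ (mem_pairBoundCone.mpr ⟨?_, ?_, le_rfl⟩)
    · simpa [← add_smul] using smul_nonneg (by norm_num) hx
    · simp)
  obtain ⟨g₂, hg₂, hg₂F⟩ := exists_nonneg_extension_of_selfAdjoint (F.comp (incl (-2⁻¹))) (by
    intro x hx
    refine hF0 _ (mem_pairBoundCone.mpr ⟨?_, ?_, le_rfl⟩)
    · simp
    · simpa [← add_smul] using smul_nonneg (by norm_num) hx)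
  refine ⟨g₁, g₂, hg₁, hg₂, ?_, ?_⟩
  · have hsa (x : selfAdjoint A) : g x = g₁ x - g₂ x := by
      rw [hg₁F, hg₂F, ← Complex.ofReal_sub, LinearMap.comp_apply, LinearMap.comp_apply, ← map_sub,
        hincl, hincl]
      have : ((2⁻¹ : ℝ) • x, (2⁻¹ : ℝ) • x, (0 : ℝ)) - ((2⁻¹ : ℝ) • x, (-2⁻¹ : ℝ) • x, (0 : ℝ))
          = (0, x, 0) := by
        simp [← add_smul, ← two_mul]
      rw [this, hFψ]
      apply Complex.ext <;> simp [im_apply_eq_zero_of_isSelfAdjoint hg x.2]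
    ext x
    rw [← realPart_add_I_smul_imaginaryPart x]
    simp only [map_add, map_smul, sub_apply, hsa, smul_eq_mul]
  · have h1 := hF0 (-1, 0, 1) (mem_pairBoundCone.mpr (by simp))
    have h2 : F (-1, 0, 1) = F (0, 0, 1) - F (1, 0, 0) := by simp [← map_sub]
    have h3 : F (1, 0, 0) = F (incl 2⁻¹ 1) + F (incl (-2⁻¹) 1) := by
      rw [← map_add, hincl, hincl]
      simp [← add_smul, ← two_mul]
    have e₁ : (g₁ 1).re = F (incl 2⁻¹ 1) := by simpa using congrArg Complex.re (hg₁F 1)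
    have e₂ : (g₂ 1).re = F (incl (-2⁻¹) 1) := by simpa using congrArg Complex.re (hg₂F 1)
    have h4 : F (0, 0, 1) = ‖g‖ := by simp [hFψ]
    linarith

lemma sandwich_apply_conjSqrt (a : A) (f : A →L[ℂ] ℂ) (x : A) :
    sandwich a f x = f (CFC.conjSqrt a x) := sandwich_apply a f x

lemma sandwich_nonneg (a : A) {f : A →L[ℂ] ℂ} (hf : ∀ x : A, 0 ≤ x → 0 ≤ f x) (x : A)
    (hx : 0 ≤ x) : 0 ≤ sandwich a f x := by
  rw [sandwich_apply_conjSqrt]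
  refine hf _ ?_
  simpa using CFC.conjSqrt_monotone (c := a) hx

lemma sandwich_apply_one {a : A} (ha : 0 ≤ a) (f : A →L[ℂ] ℂ) : sandwich a f 1 = f a := by
  rw [sandwich_apply_conjSqrt, CFC.conjSqrt_one a]

lemma sandwich_star (a : A) {f : A →L[ℂ] ℂ}
    (hf : ∀ x : A, f (star x) = starRingEnd ℂ (f x)) (x : A) :
    sandwich a f (star x) = starRingEnd ℂ (sandwich a f x) := by
  have hs : star (CFC.sqrt a) = CFC.sqrt a := (CFC.sqrt_nonneg a).isSelfAdjoint.star_eq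
  simp only [sandwich_apply, ← hf, star_mul, hs, mul_assoc]

lemma continuousOn_sandwich (f : A →L[ℂ] ℂ) :
    ContinuousOn (fun a : A ↦ sandwich a f) {a | 0 ≤ a} := by
  have h : ContinuousOn (CFC.sqrt : A → A) {a | 0 ≤ a} := CFC.continuousOn_sqrt
  unfold sandwich
  fun_prop

lemma norm_sandwich_sub_le {a : A} (ha : 0 ≤ a) {f₁ f₂ : A →L[ℂ] ℂ}
    (hf₁ : ∀ x : A, 0 ≤ x → 0 ≤ f₁ x) (hf₂ : ∀ x : A, 0 ≤ x → 0 ≤ f₂ x) :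
    ‖sandwich a (f₁ - f₂)‖ ≤ (f₁ a).re + (f₂ a).re := by
  have h : sandwich a (f₁ - f₂) = sandwich a f₁ - sandwich a f₂ := by
    ext x; simp [sandwich_apply]
  rw [h, ← sandwich_apply_one ha, ← sandwich_apply_one ha f₂]
  exact (norm_sub_le _ _).trans (add_le_add
    (norm_le_re_apply_one_of_nonneg (sandwich_nonneg a hf₁))
    (norm_le_re_apply_one_of_nonneg (sandwich_nonneg a hf₂)))

lemma exists_nonneg_sub_nonneg_of_isStrictlyPositive {b : A} (hb : IsStrictlyPositive b)
    {f : A →L[ℂ] ℂ} (hf : ∀ x : A, f (star x) = starRingEnd ℂ (f x)) :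
    ∃ f₁ f₂ : A →L[ℂ] ℂ, (∀ x : A, 0 ≤ x → 0 ≤ f₁ x) ∧ (∀ x : A, 0 ≤ x → 0 ≤ f₂ x) ∧
      f = f₁ - f₂ ∧ (f₁ b).re + (f₂ b).re ≤ ‖sandwich b f‖ := by
  obtain ⟨g₁, g₂, hg₁, hg₂, hg, hle⟩ :=
    exists_nonneg_sub_nonneg (sandwich b f) (sandwich_star b hf)
  refine ⟨sandwich (Ring.inverse b) g₁, sandwich (Ring.inverse b) g₂, sandwich_nonneg _ hg₁,
    sandwich_nonneg _ hg₂, ?_, ?_⟩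
  · ext x
    have := DFunLike.congr_fun hg (CFC.conjSqrt (Ring.inverse b) x)
    rw [sandwich_apply_conjSqrt, CFC.conjSqrt_conjSqrt_ringInverse b] at this
    simpa [sandwich_apply_conjSqrt] using this
  · simpa only [sandwich_apply_conjSqrt, CFC.conjSqrt_ringInverse_self b] using hle

end

/-- For `0 ≤ a` in a unital C*-algebra `A` and a hermitian continuous
linear functional `f` on `A`,
`‖√a·f·√a‖ = sInf { Re f₁(a) + Re f₂(a) | f = f₁ - f₂, f₁, f₂ positive }`. -/
theorem stmt6 {A : Type*} [CStarAlgebra A] [PartialOrder A] [StarOrderedRing A]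
    (a : A) (ha : 0 ≤ a) (f : A →L[ℂ] ℂ)
    (hf : ∀ x : A, f (star x) = starRingEnd ℂ (f x)) :
    ‖sandwich a f‖ = sInf {r : ℝ | ∃ f₁ f₂ : A →L[ℂ] ℂ,
        (∀ x : A, 0 ≤ x → 0 ≤ f₁ x) ∧ (∀ x : A, 0 ≤ x → 0 ≤ f₂ x) ∧
        f = f₁ - f₂ ∧ r = (f₁ a).re + (f₂ a).re} := by
  set S := {r : ℝ | ∃ f₁ f₂ : A →L[ℂ] ℂ,
    (∀ x : A, 0 ≤ x → 0 ≤ f₁ x) ∧ (∀ x : A, 0 ≤ x → 0 ≤ f₂ x) ∧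
    f = f₁ - f₂ ∧ r = (f₁ a).re + (f₂ a).re}
  have hlb : ∀ r ∈ S, ‖sandwich a f‖ ≤ r := by
    rintro _ ⟨f₁, f₂, hf₁, hf₂, rfl, rfl⟩
    exact norm_sandwich_sub_le ha hf₁ hf₂
  have hbdd : BddBelow S := ⟨_, hlb⟩
  obtain ⟨g₁, g₂, hg₁, hg₂, hg, -⟩ := exists_nonneg_sub_nonneg f hf
  refine le_antisymm (le_csInf ⟨_, g₁, g₂, hg₁, hg₂, hg, rfl⟩ hlb) ?_
  have hpos (t : ℝ) (ht : 0 ≤ t) : a ≤ a + algebraMap ℝ A t :=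
    le_add_of_nonneg_right (algebraMap_nonneg A ht)
  have hcont : ContinuousOn (fun t : ℝ ↦ ‖sandwich (a + algebraMap ℝ A t) f‖) (Set.Ici 0) :=
    ((continuousOn_sandwich f).comp (by fun_prop) fun t ht ↦ ha.trans (hpos t ht)).norm
  have hlim := (hcont 0 Set.self_mem_Ici).mono_left (nhdsWithin_mono 0 Set.Ioi_subset_Ici_self)
  simp only [map_zero, add_zero] at hlim
  refine ge_of_tendsto hlim (Filter.eventually_of_mem self_mem_nhdsWithin fun t ht ↦ ?_)
  have hb : IsStrictlyPositive (a + algebraMap ℝ A t) :=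
    IsStrictlyPositive.nonneg_add ha (isStrictlyPositive_algebraMap ht)
  obtain ⟨f₁, f₂, hf₁, hf₂, hsub, hle⟩ := exists_nonneg_sub_nonneg_of_isStrictlyPositive hb hf
  refine (csInf_le hbdd ⟨f₁, f₂, hf₁, hf₂, hsub, rfl⟩).trans (le_trans ?_ hle)
  have mono {φ : A →L[ℂ] ℂ} (hφ : ∀ x : A, 0 ≤ x → 0 ≤ φ x) :
      (φ a).re ≤ (φ (a + algebraMap ℝ A t)).re := by
    have := (Complex.nonneg_iff.mp (hφ _ (sub_nonneg.mpr (hpos t (le_of_lt ht))))).1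
    rw [map_sub, Complex.sub_re] at this
    linarith
  exact add_le_add (mono hf₁) (mono hf₂)
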